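/- Let n ≥ 6 and let T be any 4-element set of vertices of the complete graph K_n. Then the graft matroid of (K_n, T) has an AG(3,2)-minor. -/

import Mathlib

open Matroid Set

variable {α : Type*}

/-- Deletion of a set of elements from a matroid. -/
def Matroid.del (M : Matroid α) (D : Set α) : Matroid α := M ↾ (M.E \ D)

/-- Contraction of a set of elements in a matroid, defined by duality. -/
def Matroid.con (M : Matroid α) (C : Set α) : Matroid α := ((M✶).del C)✶

/-- `N` is a minor of `M` if it is obtained from `M` by a contraction followed by a deletion. -/
def Matroid.IsMinorOf (N M : Matroid α) : Prop := ∃ C D : Set α, N = (M.con C).del D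

/-- `C` is a circuit of `M`: a dependent set all of whose proper subsets are independent. -/
def Matroid.IsCircuitSet (M : Matroid α) (C : Set α) : Prop :=
  M.Dep C ∧ ∀ D ⊂ C, M.Indep D

/-- A matroid is simple if it has no circuits of size one or two, equivalently every
one- or two-element subset of the ground set is independent. -/
def Matroid.IsSimpleM (M : Matroid α) : Prop := ∀ e ∈ M.E, ∀ f ∈ M.E, M.Indep {e, f}

/-- The rank of a set `X` in a matroid `M`: the supremum of the sizes of independent
subsets of `X`. -/
noncomputable def Matroid.rks (M : Matroid α) (X : Set α) : ℕ :=
  sSup {n : ℕ | ∃ I ⊆ X, M.Indep I ∧ I.ncard = n}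

/-- The rank of a matroid. -/
noncomputable def Matroid.rkM (M : Matroid α) : ℕ := M.rks M.E

/-- `M` is represented over the field `F` by the vector assignment `φ`:
a subset of the ground set is independent iff `φ` is linearly independent on it. -/
def Matroid.IsRepBy (M : Matroid α) (F : Type*) [Field F] {W : Type*} [AddCommGroup W]
    [Module F W] (φ : α → W) : Prop :=
  ∀ I ⊆ M.E, (M.Indep I ↔ LinearIndependent F (I.restrict φ))

/-- `M` is representable over the field `F`. -/
def Matroid.IsRepOver (M : Matroid α) (F : Type) [Field F] : Prop :=
  ∃ (n : ℕ) (φ : α → (Fin n → F)), M.IsRepBy F φ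

/-- A binary matroid is one representable over the two-element field `GF(2)`. -/
def Matroid.IsBinaryM (M : Matroid α) : Prop := M.IsRepOver (ZMod 2)

/-- A regular matroid is one representable over every field. -/
def Matroid.IsRegularM (M : Matroid α) : Prop := ∀ (F : Type) [Field F], M.IsRepOver F

/-- `M` is isomorphic to the binary vector matroid on the set of vectors `V`:
there is a representation of `M` over `GF(2)` mapping the ground set bijectively to `V`. -/
def Matroid.IsBinaryIsoTo (M : Matroid α) {W : Type*} [AddCommGroup W] [Module (ZMod 2) W]
    (V : Set W) : Prop :=
  ∃ φ : α → W, M.IsRepBy (ZMod 2) φ ∧ Set.BijOn φ M.E V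

/-- The eight points of the binary affine cube `AG(3,2)`: the vectors `(1, x)` in `GF(2)⁴`. -/
def agVecs : Set (Fin 4 → ZMod 2) := {x | x 0 = 1}

/-- `M` has a minor isomorphic to `AG(3,2)`. -/
def Matroid.HasAGMinor (M : Matroid α) : Prop :=
  ∃ N : Matroid α, N.IsMinorOf M ∧ N.IsBinaryIsoTo agVecs

/-- The seven points of the Fano plane `F₇`: the nonzero vectors of `GF(2)³`. -/
def fanoVecs : Set (Fin 3 → ZMod 2) := {x | x ≠ 0}

/-- The vectors `eᵢ + eⱼ` (`i ≠ j`) representing the graphic matroid `M(K_n)`. -/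
def kVecs (n : ℕ) : Set (Fin n → ZMod 2) :=
  {x | ∃ i j : Fin n, i ≠ j ∧ x = Pi.single i 1 + Pi.single j 1}

/-- `ℓ` is a line (3-element circuit) of `M` through `x`. -/
def Matroid.IsLineThru (M : Matroid α) (x : α) (ℓ : Set α) : Prop :=
  M.IsCircuitSet ℓ ∧ ℓ.ncard = 3 ∧ x ∈ ℓ

/-- A matroid is connected if it is nonempty and every two distinct elements of the
ground set lie in a common circuit. -/
def Matroid.IsConnectedM (M : Matroid α) : Prop :=
  M.E.Nonempty ∧ ∀ e ∈ M.E, ∀ f ∈ M.E, e ≠ f →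
    ∃ C, M.IsCircuitSet C ∧ e ∈ C ∧ f ∈ C

/-- A matroid is 3-connected if it is connected and has no 2-separation, i.e. no partition
`(A, B)` of the ground set with `|A| ≥ 2`, `|B| ≥ 2` and `r(A) + r(B) - r(M) ≤ 1`. -/
def Matroid.IsThreeConnected (M : Matroid α) : Prop :=
  M.IsConnectedM ∧ ¬ ∃ A B : Set α, A ∪ B = M.E ∧ Disjoint A B ∧
    2 ≤ A.ncard ∧ 2 ≤ B.ncard ∧ M.rks A + M.rks B ≤ M.rkM + 1

/-- The columns of the representation of the graft matroid of `(K_n, T)`: the incidence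
vectors `eᵢ + eⱼ` of the edges of `K_n` together with the characteristic vector of `T`. -/
def knGraftVecs (n : ℕ) (T : Finset (Fin n)) : Set (Fin n → ZMod 2) :=
  kVecs n ∪ {fun i => if i ∈ T then 1 else 0}

/-- Linear independence after projecting from the vector `f t`. -/
lemma indepOn_insert_iff_proj {β W W' : Type*} [AddCommGroup W] [Module (ZMod 2) W]
    [AddCommGroup W'] [Module (ZMod 2) W'] (ψ : W →ₗ[ZMod 2] W') (f : β → W) (t : β)
    (I : Set β) (htI : t ∉ I) (ht0 : f t ≠ 0) (htk : ψ (f t) = 0)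
    (hker : ∀ x ∈ Submodule.span (ZMod 2) (f '' I), ψ x = 0 → x = 0 ∨ x = f t) :
    LinearIndepOn (ZMod 2) f (insert t I) ↔ LinearIndepOn (ZMod 2) (ψ ∘ f) I := by
  rw [linearIndepOn_insert htI]
  constructor
  · rintro ⟨hI, hsp⟩
    refine hI.map_injOn ψ (LinearMap.injOn_of_disjoint_ker le_rfl ?_)
    rw [LinearMap.disjoint_ker]
    intro x hx hx0
    rcases hker x hx hx0 with h | h
    · exact h
    · exact absurd (h ▸ hx) hsp
  · intro h
    refine ⟨h.of_comp ψ, fun hsp => ht0 ?_⟩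
    have hd := Submodule.range_ker_disjoint (v := fun i : I => f i) (f := ψ) h
    rw [LinearMap.disjoint_ker] at hd
    refine hd _ ?_ htk
    rwa [← Set.image_eq_range]

/-- The projection from the graft vector. -/
def graftProj (n : ℕ) (τ : Fin 4 → Fin n) (p : Fin n) :
    (Fin n → ZMod 2) →ₗ[ZMod 2] (Fin 4 → ZMod 2) where
  toFun x := ![x (τ 0) + x (τ 1) + x (τ 2) + x (τ 3), x (τ 0) + x (τ 3), x (τ 1) + x (τ 3), x p]
  map_add' x y := by
    ext i; fin_cases i <;> simp <;> ring
  map_smul' c x := by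
    ext i; fin_cases i <;> simp <;> ring

/-- The image under `graftProj` of the edge joining `τ i` to `p` or `q`. -/
def edgeImg (k : Fin 4 × Fin 2) : Fin 4 → ZMod 2 :=
  ![1, if k.1 = 0 ∨ k.1 = 3 then 1 else 0, if k.1 = 1 ∨ k.1 = 3 then 1 else 0,
    if k.2 = 0 then 1 else 0]

lemma edgeImg_inj : Function.Injective edgeImg := by decide

lemma edgeImg_surj : ∀ y : Fin 4 → ZMod 2, y 0 = 1 → ∃ k, edgeImg k = y := by decide

lemma scalar_ker : ∀ a b c d p q : ZMod 2, a + b + c + d + p + q = 0 → a + b + c + d = 0 →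
    a + d = 0 → b + d = 0 → p = 0 → a = d ∧ b = d ∧ c = d ∧ q = 0 := by decide

theorem kn_graft_has_AG_minor {α : Type*} (n : ℕ) (hn : 6 ≤ n)
    (T : Finset (Fin n)) (hT : T.card = 4)
    (M : Matroid α) (φ : α → (Fin n → ZMod 2))
    (hrep : M.IsRepBy (ZMod 2) φ) (hbij : Set.BijOn φ M.E (knGraftVecs n T)) :
    M.HasAGMinor := by
  classical
  -- the vertices of `T` and two further vertices
  obtain ⟨τ, hτ, hτT⟩ : ∃ τ : Fin 4 → Fin n, Function.Injective τ ∧ ∀ v, v ∈ T ↔ ∃ i, τ i = v := by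
    refine ⟨T.orderEmbOfFin hT, (T.orderEmbOfFin hT).injective, fun v => ?_⟩
    have := Finset.range_orderEmbOfFin T hT
    rw [← Finset.mem_coe, ← this, Set.mem_range]
  obtain ⟨p, hp, q, hq, hpq⟩ : ∃ p ∈ Tᶜ, ∃ q ∈ Tᶜ, p ≠ q := by
    apply Finset.one_lt_card.1
    rw [Finset.card_compl, hT, Fintype.card_fin]
    omega
  have hpτ : ∀ i, τ i ≠ p := fun i h => Finset.mem_compl.1 hp ((hτT p).2 ⟨i, h⟩)
  have hqτ : ∀ i, τ i ≠ q := fun i h => Finset.mem_compl.1 hq ((hτT q).2 ⟨i, h⟩)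
  set w : Fin n → ZMod 2 := fun i => if i ∈ T then 1 else 0 with hw
  have hwτ : ∀ i, w (τ i) = 1 := fun i => if_pos ((hτT _).2 ⟨i, rfl⟩)
  have hwp : w p = 0 := if_neg (Finset.mem_compl.1 hp)
  have hwq : w q = 0 := if_neg (Finset.mem_compl.1 hq)
  let ψ := graftProj n τ p
  let r : Fin 2 → Fin n := ![p, q]
  let u : Fin 4 × Fin 2 → Fin n → ZMod 2 := fun k => Pi.single (τ k.1) 1 + Pi.single (r k.2) 1
  have hru : ∀ i j, τ i ≠ r j := by
    intro i j; fin_cases j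
    · exact hpτ i
    · exact hqτ i
  have hψu : ∀ k, ψ (u k) = edgeImg k := by
    rintro ⟨i, j⟩
    have h1 : ∀ a, u (i, j) (τ a) = if a = i then 1 else 0 := by
      intro a
      simp [u, Pi.single_apply, hτ.eq_iff, hru]
    have h2 : u (i, j) p = if j = 0 then 1 else 0 := by
      fin_cases j
      · simp [u, r, Pi.single_apply, (hpτ i).symm]
      · simp [u, r, Pi.single_apply, (hpτ i).symm, hpq]
    change ![_, _, _, _] = ![_, _, _, _]
    rw [h1, h1, h1, h1, h2]
    clear h1 h2
    revert i j
    decide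
  have hu_mem : ∀ k, u k ∈ knGraftVecs n T := fun k =>
    Or.inl ⟨τ k.1, r k.2, hru _ _, rfl⟩
  have hu_q : ∀ k, u k p + u k q = 1 := by
    rintro ⟨i, j⟩
    fin_cases j
    · simp [u, r, Pi.single_apply, (hpτ i).symm, (hqτ i).symm, hpq.symm]
    · simp [u, r, Pi.single_apply, (hpτ i).symm, (hqτ i).symm, hpq]
  have hw_ne : ∀ k, u k ≠ w := by
    intro k h
    have := hu_q k
    rw [h, hwp, hwq] at this
    simp at this
  -- the graft element
  obtain ⟨t, htE, htw⟩ := hbij.surjOn (show w ∈ knGraftVecs n T from Or.inr rfl)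
  have hw0 : w ≠ 0 := by
    intro h
    have := hwτ 0
    rw [h] at this
    simp at this
  have hψw : ψ w = 0 := by
    change ![_, _, _, _] = _
    rw [hwτ, hwτ, hwτ, hwτ, hwp]
    decide
  have htI : M.Indep {t} := by
    rw [hrep _ (by simpa using htE)]
    change LinearIndepOn (ZMod 2) φ {t}
    rw [linearIndepOn_singleton_iff, htw]
    exact hw0
  let A : Set α := {e | e ∈ M.E ∧ φ e ∈ Set.range u}
  have htA : t ∉ A := by
    rintro ⟨-, k, hk⟩
    exact hw_ne k (hk.trans htw)
  have hspan : ∀ x ∈ Submodule.span (ZMod 2) (φ '' A),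
      (∀ v, v ∉ T → v ≠ p → v ≠ q → x v = 0) ∧
      x (τ 0) + x (τ 1) + x (τ 2) + x (τ 3) + x p + x q = 0 := by
    intro x hx
    induction hx using Submodule.span_induction with
    | mem x hx =>
      obtain ⟨e, ⟨-, k, hk⟩, rfl⟩ := hx
      rw [← hk]
      constructor
      · intro v hvT hvp hvq
        have h1 : v ≠ τ k.1 := fun h => hvT ((hτT v).2 ⟨_, h.symm⟩)
        have h2 : v ≠ r k.2 := by
          obtain ⟨i, j⟩ := k
          fin_cases j
          · exact hvp
          · exact hvq
        simp [u, Pi.single_apply, h1, h2]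
      · have h1 := congrFun (hψu k) 0
        change u k (τ 0) + u k (τ 1) + u k (τ 2) + u k (τ 3) = 1 at h1
        rw [h1, add_assoc, hu_q]
        decide
    | zero => simp
    | add x y _ _ hx hy =>
      refine ⟨fun v h1 h2 h3 => by simp [hx.1 v h1 h2 h3, hy.1 v h1 h2 h3], ?_⟩
      simp only [Pi.add_apply]
      linear_combination hx.2 + hy.2
    | smul c x _ hx =>
      refine ⟨fun v h1 h2 h3 => by simp [hx.1 v h1 h2 h3], ?_⟩
      simp only [Pi.smul_apply, smul_eq_mul]
      linear_combination c * hx.2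
  have hker : ∀ x ∈ Submodule.span (ZMod 2) (φ '' A), ψ x = 0 → x = 0 ∨ x = φ t := by
    intro x hx h0
    obtain ⟨hs, hsum⟩ := hspan x hx
    have e0 := congrFun h0 0
    have e1 := congrFun h0 1
    have e2 := congrFun h0 2
    have e3 := congrFun h0 3
    change x (τ 0) + x (τ 1) + x (τ 2) + x (τ 3) = 0 at e0
    change x (τ 0) + x (τ 3) = 0 at e1
    change x (τ 1) + x (τ 3) = 0 at e2
    change x p = 0 at e3
    obtain ⟨ha, hb, hc, hxq⟩ := scalar_ker _ _ _ _ _ _ hsum e0 e1 e2 e3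
    have hall : ∀ i, x (τ i) = x (τ 3) := by
      intro i
      fin_cases i
      · exact ha
      · exact hb
      · exact hc
      · rfl
    have key : ∀ v, x v = x (τ 3) * w v := by
      intro v
      by_cases hv : v ∈ T
      · obtain ⟨i, rfl⟩ := (hτT v).1 hv
        rw [hwτ, mul_one, hall]
      · have hwv : w v = 0 := if_neg hv
        rw [hwv, mul_zero]
        by_cases h1 : v = p
        · rw [h1, e3]
        by_cases h2 : v = q
        · rw [h2, hxq]
        exact hs v hv h1 h2
    have h01 : ∀ c : ZMod 2, c = 0 ∨ c = 1 := by decide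
    rcases h01 (x (τ 3)) with h | h
    · left; ext v; rw [key, h, zero_mul]; rfl
    · right; ext v; rw [key, h, one_mul, htw]
  have hAE : A ⊆ M.E := fun e he => he.1
  refine ⟨(M.con {t}).del ((M.E \ {t}) \ A), ⟨_, _, rfl⟩, ψ ∘ φ, ?_, ?_⟩
  · have hE : ((M.con {t}).del ((M.E \ {t}) \ A)).E = A := by
      change (M.E \ {t}) \ ((M.E \ {t}) \ A) = A
      rw [Set.sdiff_sdiff_cancel_left]
      exact fun e he => ⟨he.1, fun h => htA (h ▸ he)⟩
    intro I hI
    rw [hE] at hI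
    have htnI : t ∉ I := fun h => htA (hI h)
    change ((M.contract {t}).delete ((M.E \ {t}) \ A)).Indep I ↔ LinearIndepOn (ZMod 2) (ψ ∘ φ) I
    rw [delete_indep_iff, htI.contract_indep_iff, Set.union_singleton, hrep _
      (Set.insert_subset htE (hI.trans hAE))]
    have hpr := indepOn_insert_iff_proj ψ φ t I htnI (htw ▸ hw0) (htw ▸ hψw)
      (fun x hx => hker x (Submodule.span_mono (Set.image_mono hI) hx))
    rw [← hpr]
    constructor
    · exact fun h => h.1.2
    · refine fun h => ⟨⟨Set.disjoint_singleton_right.2 htnI, h⟩, ?_⟩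
      exact Set.disjoint_left.2 fun e he h' => h'.2 (hI he)
  · have hE : ((M.con {t}).del ((M.E \ {t}) \ A)).E = A := by
      change (M.E \ {t}) \ ((M.E \ {t}) \ A) = A
      rw [Set.sdiff_sdiff_cancel_left]
      exact fun e he => ⟨he.1, fun h => htA (h ▸ he)⟩
    rw [hE]
    refine ⟨?_, ?_, ?_⟩
    · rintro e ⟨-, k, hk⟩
      change ψ (φ e) 0 = 1
      rw [← hk, hψu]
      rfl
    · rintro e ⟨heE, k, hk⟩ e' ⟨heE', k', hk'⟩ h
      apply hbij.injOn heE heE'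
      change ψ (φ e) = ψ (φ e') at h
      rw [← hk, ← hk', hψu, hψu] at h
      rw [← hk, ← hk', edgeImg_inj h]
    · intro y hy
      obtain ⟨k, hk⟩ := edgeImg_surj y hy
      obtain ⟨e, heE, he⟩ := hbij.surjOn (hu_mem k)
      refine ⟨e, ⟨heE, k, he.symm⟩, ?_⟩
      change ψ (φ e) = y
      rw [he, hψu, hk]
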